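/- arXiv:2203.12359 — 7 statements merged into one kernel-verified Lean document; each statement's English description precedes it below -/
import Mathlib

section
/- Let w be a convex metric modular on a set X and let x, y ∈ X with x ≠ y. If there exists λ' > 0 with w_{λ'}(x, y) < ∞ and w_{λ'}(x, y) > 0 for some such λ', then w_λ(x, y) → ∞ as λ → 0+. -/
open ENNReal Filter Topology

/-- A convex metric modular satisfies `w m x y ≤ (l / m) w l x y` for `0 < l < m`. -/
theorem convex_modular_le_mul {X : Type*} (w : ℝ → X → X → ℝ≥0∞)
    (h1 : ∀ x y : X, (∀ l : ℝ, 0 < l → w l x y = 0) ↔ x = y)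
    (h3 : ∀ l m : ℝ, 0 < l → 0 < m → ∀ x y z : X,
      w (l + m) x y ≤ ENNReal.ofReal (l / (l + m)) * w l x z
        + ENNReal.ofReal (m / (l + m)) * w m z y)
    (x y : X) {l m : ℝ} (hl : 0 < l) (hlm : l < m) :
    w m x y ≤ ENNReal.ofReal (l / m) * w l x y := by
  have h := h3 l (m - l) hl (sub_pos.2 hlm) x y y
  rwa [(h1 y y).2 rfl _ (sub_pos.2 hlm), mul_zero, add_zero, add_sub_cancel] at h

/-- for a convex metric modular `w` and `x ≠ y`, if there is `l' > 0` with
`0 < w l' x y < ∞`, then `w l x y → ∞` as `l → 0+`. -/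
theorem convex_modular_tendsto_top_at_zero {X : Type*} (w : ℝ → X → X → ℝ≥0∞)
    (h1 : ∀ x y : X, (∀ l : ℝ, 0 < l → w l x y = 0) ↔ x = y)
    (h2 : ∀ l : ℝ, 0 < l → ∀ x y : X, w l x y = w l y x)
    (h3 : ∀ l m : ℝ, 0 < l → 0 < m → ∀ x y z : X,
      w (l + m) x y ≤ ENNReal.ofReal (l / (l + m)) * w l x z
        + ENNReal.ofReal (m / (l + m)) * w m z y)
    (x y : X) (hxy : x ≠ y)
    (hfin : ∃ l' : ℝ, 0 < l' ∧ w l' x y < ⊤ ∧ 0 < w l' x y) :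
    Tendsto (fun l : ℝ => w l x y) (𝓝[>] (0 : ℝ)) (𝓝 ⊤) := by
  obtain ⟨m, hm, -, hpos⟩ := hfin
  have hdiv : Tendsto (fun l : ℝ => m / l) (𝓝[>] (0 : ℝ)) atTop := by
    simpa only [div_eq_mul_inv] using tendsto_inv_nhdsGT_zero.const_mul_atTop hm
  have hlower : Tendsto (fun l : ℝ => ENNReal.ofReal (m / l) * w m x y) (𝓝[>] (0 : ℝ)) (𝓝 ⊤) := by
    have h := ENNReal.Tendsto.mul_const (b := w m x y)
      (ENNReal.tendsto_ofReal_atTop.comp hdiv) (Or.inl ENNReal.top_ne_zero)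
    rwa [ENNReal.top_mul hpos.ne'] at h
  refine tendsto_of_tendsto_of_tendsto_of_le_of_le' hlower tendsto_const_nhds ?_
    (Eventually.of_forall fun _ => le_top)
  filter_upwards [Ioo_mem_nhdsGT hm] with l hl
  calc ENNReal.ofReal (m / l) * w m x y
      ≤ ENNReal.ofReal (m / l) * (ENNReal.ofReal (l / m) * w l x y) := by
        gcongr
        exact convex_modular_le_mul w h1 h3 x y hl.1 hl.2
    _ = w l x y := by
        rw [← mul_assoc, ← ENNReal.ofReal_mul (div_pos hm hl.1).le,
          div_mul_div_cancel₀ hl.1.ne', div_self hm.ne', ENNReal.ofReal_one, one_mul]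
end

section
/- Let w be a convex metric modular on a set X. Then the function v defined by v_λ(x, y) = w_λ(x, y)/λ is a metric modular on X; that is, v satisfies: v_λ(x,y) = 0 for all λ > 0 iff x = y; v_λ(x,y) = v_λ(y,x) for all λ > 0; and v_{λ+μ}(x,y) ≤ v_λ(x,z) + v_μ(z,y) for all λ, μ > 0 and all x, y, z ∈ X. -/
open ENNReal

/-- Scaling by a proportion `l / s` with `l ≤ s` and dividing by `s` gives at most the quotient
by `l`. -/
theorem ofReal_div_mul_div_ofReal_le {l s : ℝ} (hl : 0 < l) (hls : l ≤ s) (c : ℝ≥0∞) :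
    ENNReal.ofReal (l / s) * c / ENNReal.ofReal s ≤ c / ENNReal.ofReal l := by
  have hle : ENNReal.ofReal (l / s) ≤ 1 :=
    ENNReal.ofReal_le_one.2 (div_le_one_of_le₀ hls (hl.le.trans hls))
  exact ENNReal.div_le_div (mul_le_of_le_one_left' hle) (ENNReal.ofReal_le_ofReal hls)

/-- if `w` is a convex metric modular on `X`, then
`v l x y = w l x y / l` is a metric modular on `X`. -/
theorem div_of_convex_modular_is_modular {X : Type*} (w : ℝ → X → X → ℝ≥0∞)
    (h1 : ∀ x y : X, (∀ l : ℝ, 0 < l → w l x y = 0) ↔ x = y)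
    (h2 : ∀ l : ℝ, 0 < l → ∀ x y : X, w l x y = w l y x)
    (h3 : ∀ l m : ℝ, 0 < l → 0 < m → ∀ x y z : X,
      w (l + m) x y ≤ ENNReal.ofReal (l / (l + m)) * w l x z
        + ENNReal.ofReal (m / (l + m)) * w m z y)
    (v : ℝ → X → X → ℝ≥0∞)
    (hv : ∀ l : ℝ, 0 < l → ∀ x y : X, v l x y = w l x y / ENNReal.ofReal l) :
    (∀ x y : X, (∀ l : ℝ, 0 < l → v l x y = 0) ↔ x = y) ∧
    (∀ l : ℝ, 0 < l → ∀ x y : X, v l x y = v l y x) ∧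
    (∀ l m : ℝ, 0 < l → 0 < m → ∀ x y z : X,
      v (l + m) x y ≤ v l x z + v m z y) := by
  refine ⟨fun x y => ?_, fun l hl x y => ?_, fun l m hl hm x y z => ?_⟩
  · rw [← h1 x y]
    refine forall₂_congr fun l hl => ?_
    rw [hv l hl, ENNReal.div_eq_zero_iff, or_iff_left ENNReal.ofReal_ne_top]
  · rw [hv l hl, hv l hl, h2 l hl]
  · rw [hv _ (add_pos hl hm), hv l hl, hv m hm]
    calc w (l + m) x y / ENNReal.ofReal (l + m)
        ≤ (ENNReal.ofReal (l / (l + m)) * w l x z + ENNReal.ofReal (m / (l + m)) * w m z y)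
            / ENNReal.ofReal (l + m) := ENNReal.div_le_div_right (h3 l m hl hm x y z) _
      _ ≤ w l x z / ENNReal.ofReal l + w m z y / ENNReal.ofReal m := by
        rw [ENNReal.add_div]
        exact add_le_add (ofReal_div_mul_div_ofReal_le hl (by linarith) _)
          (ofReal_div_mul_div_ofReal_le hm (by linarith) _)
end

section
/- Let w be a convex metric modular on a set X and x₀ ∈ X. Then X_w(x₀) = X_w^*(x₀), where X_w(x₀) = {x ∈ X : w_λ(x, x₀) → 0 as λ → ∞} and X_w^*(x₀) = {x ∈ X : ∃λ > 0, w_λ(x, x₀) < ∞}. -/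
open ENNReal Filter Topology

/-- for a convex metric modular `w`, `X_w(x₀) = X_w^*(x₀)`. -/
theorem modular_sets_eq_of_convex {X : Type*} (w : ℝ → X → X → ℝ≥0∞)
    (h1 : ∀ x y : X, (∀ l : ℝ, 0 < l → w l x y = 0) ↔ x = y)
    (h2 : ∀ l : ℝ, 0 < l → ∀ x y : X, w l x y = w l y x)
    (h3 : ∀ l m : ℝ, 0 < l → 0 < m → ∀ x y z : X,
      w (l + m) x y ≤ ENNReal.ofReal (l / (l + m)) * w l x z
        + ENNReal.ofReal (m / (l + m)) * w m z y)
    (x₀ : X) :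
    {x : X | Tendsto (fun l : ℝ => w l x x₀) atTop (𝓝 0)} =
      {x : X | ∃ l : ℝ, 0 < l ∧ w l x x₀ < ⊤} := by
  ext x
  constructor
  · intro hx
    obtain ⟨l, hl, hl0⟩ :=
      ((Tendsto.eventually_lt_const ENNReal.zero_lt_top hx).and (eventually_gt_atTop 0)).exists
    exact ⟨l, hl0, hl⟩
  · rintro ⟨r, hr, hfin⟩
    have hlim : Tendsto (fun l : ℝ => ENNReal.ofReal (r / l) * w r x x₀) atTop (𝓝 0) := by
      have h := ENNReal.tendsto_ofReal (tendsto_const_nhds.div_atTop tendsto_id : Tendsto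
        (fun l : ℝ => r / l) atTop (𝓝 0))
      simpa using ENNReal.Tendsto.mul_const h (Or.inr hfin.ne)
    refine tendsto_of_tendsto_of_tendsto_of_le_of_le' tendsto_const_nhds hlim
      (Eventually.of_forall fun _ => zero_le) ?_
    filter_upwards [eventually_gt_atTop r] with l hl
    have hself : w (l - r) x₀ x₀ = 0 := (h1 x₀ x₀).2 rfl _ (sub_pos.2 hl)
    simpa [hself] using h3 r (l - r) hr (sub_pos.2 hl) x x₀ x₀
end

section
/- Let w be a metric modular on a set X and let x₀ ∈ X. Then the formula d_w(x, y) = inf{λ > 0 : w_λ(x, y) ≤ λ} defines a metric on the modular set X_w^*(x₀): d_w takes finite nonnegative values on X_w^*(x₀) × X_w^*(x₀), d_w(x, y) = 0 if and only if x = y, d_w(x, y) = d_w(y, x), and d_w(x, y) ≤ d_w(x, z) + d_w(z, y) for all x, y, z ∈ X_w^*(x₀). -/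
open ENNReal

/-- A metric modular is nonincreasing in its parameter. -/
theorem modular_antitone {X : Type*} {w : ℝ → X → X → ℝ≥0∞}
    (h1 : ∀ x : X, ∀ l : ℝ, 0 < l → w l x x = 0)
    (h3 : ∀ l m : ℝ, 0 < l → 0 < m → ∀ x y z : X, w (l + m) x y ≤ w l x z + w m z y)
    {l m : ℝ} (hm : 0 < m) (hml : m ≤ l) (x y : X) : w l x y ≤ w m x y := by
  rcases hml.eq_or_lt with rfl | hlt
  · exact le_rfl
  · simpa [h1 x (l - m) (sub_pos.2 hlt)] using h3 (l - m) m (sub_pos.2 hlt) hm x y x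

/-- for a metric modular `w` and `x₀ ∈ X`, the formula
`d_w x y = inf {l > 0 : w l x y ≤ l}` defines a metric on the modular set
`X_w^*(x₀)`: it takes finite nonnegative values (the set over which the infimum
is taken is nonempty), vanishes exactly on the diagonal, is symmetric, and
satisfies the triangle inequality. -/
theorem dw_is_metric_on_modular_set {X : Type*} (w : ℝ → X → X → ℝ≥0∞)
    (h1 : ∀ x y : X, (∀ l : ℝ, 0 < l → w l x y = 0) ↔ x = y)
    (h2 : ∀ l : ℝ, 0 < l → ∀ x y : X, w l x y = w l y x)
    (h3 : ∀ l m : ℝ, 0 < l → 0 < m → ∀ x y z : X, w (l + m) x y ≤ w l x z + w m z y)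
    (x₀ : X)
    (S : Set X) (hS : S = {x : X | ∃ l : ℝ, 0 < l ∧ w l x x₀ < ⊤})
    (dw : X → X → ℝ)
    (hdw : ∀ x y : X, dw x y = sInf {l : ℝ | 0 < l ∧ w l x y ≤ ENNReal.ofReal l}) :
    (∀ x ∈ S, ∀ y ∈ S,
      {l : ℝ | 0 < l ∧ w l x y ≤ ENNReal.ofReal l}.Nonempty ∧ 0 ≤ dw x y) ∧
    (∀ x ∈ S, ∀ y ∈ S, (dw x y = 0 ↔ x = y)) ∧
    (∀ x ∈ S, ∀ y ∈ S, dw x y = dw y x) ∧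
    (∀ x ∈ S, ∀ y ∈ S, ∀ z ∈ S, dw x y ≤ dw x z + dw z y) := by
  have hself : ∀ x : X, ∀ l : ℝ, 0 < l → w l x x = 0 := fun x => (h1 x x).2 rfl
  have hbdd : ∀ x y : X, BddBelow {l : ℝ | 0 < l ∧ w l x y ≤ ENNReal.ofReal l} :=
    fun x y => ⟨0, fun l hl => hl.1.le⟩
  have hne : ∀ x ∈ S, ∀ y ∈ S, {l : ℝ | 0 < l ∧ w l x y ≤ ENNReal.ofReal l}.Nonempty := by
    subst hS
    rintro x ⟨a, ha, hax⟩ y ⟨b, hb, hby⟩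
    have hab : 0 < a + b := add_pos ha hb
    have hfin : w (a + b) x y ≠ ⊤ := by
      refine ((h3 a b ha hb x y x₀).trans_lt (ENNReal.add_lt_top.2 ⟨hax, ?_⟩)).ne
      rwa [h2 b hb]
    refine ⟨max (a + b) (w (a + b) x y).toReal, lt_max_of_lt_left hab, ?_⟩
    calc w (max (a + b) (w (a + b) x y).toReal) x y
        ≤ w (a + b) x y := modular_antitone hself h3 hab (le_max_left _ _) x y
      _ = ENNReal.ofReal (w (a + b) x y).toReal := (ENNReal.ofReal_toReal hfin).symm
      _ ≤ _ := ENNReal.ofReal_le_ofReal (le_max_right _ _)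
  refine ⟨fun x hx y hy => ⟨hne x hx y hy, ?_⟩, fun x hx y hy => ⟨fun h => ?_, ?_⟩,
    fun x _ y _ => ?_, fun x hx y hy z hz => ?_⟩
  · rw [hdw]
    exact Real.sInf_nonneg fun l hl => hl.1.le
  · refine (h1 x y).1 fun l hl => ?_
    rw [hdw] at h
    by_contra hwne
    obtain ⟨ε, hε, hεw⟩ := ENNReal.lt_iff_exists_nnreal_btwn.1 (pos_iff_ne_zero.2 hwne)
    have hε' : (0 : ℝ) < ε := by exact_mod_cast hε
    obtain ⟨m, ⟨hm, hwm⟩, hlt⟩ :=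
      exists_lt_of_csInf_lt (hne x hx y hy) (h.trans_lt (lt_min hl hε'))
    refine hεw.not_ge ?_
    calc w l x y ≤ w m x y :=
          modular_antitone hself h3 hm (hlt.le.trans (min_le_left _ _)) x y
      _ ≤ ENNReal.ofReal m := hwm
      _ ≤ ENNReal.ofReal ε := ENNReal.ofReal_le_ofReal (hlt.le.trans (min_le_right _ _))
      _ = ε := ENNReal.ofReal_coe_nnreal
  · rintro rfl
    have hset : {l : ℝ | 0 < l ∧ w l x x ≤ ENNReal.ofReal l} = Set.Ioi 0 := by
      ext l
      exact ⟨fun hl => hl.1, fun hl => ⟨hl, (hself x l hl).trans_le zero_le⟩⟩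
    rw [hdw, hset, csInf_Ioi]
  · rw [hdw, hdw]
    congr 1
    ext l
    exact and_congr_right fun hl => by rw [h2 l hl]
  · refine le_of_forall_pos_lt_add fun ε hε => ?_
    obtain ⟨l, ⟨hl, hwl⟩, hlt⟩ := exists_lt_of_csInf_lt (hne x hx z hz)
      (lt_add_of_pos_right _ (half_pos hε))
    obtain ⟨m, ⟨hm, hwm⟩, hmt⟩ := exists_lt_of_csInf_lt (hne z hz y hy)
      (lt_add_of_pos_right _ (half_pos hε))
    rw [← hdw] at hlt hmt
    have hle : dw x y ≤ l + m := by
      rw [hdw]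
      refine csInf_le (hbdd x y) ⟨add_pos hl hm, ?_⟩
      rw [ENNReal.ofReal_add hl.le hm.le]
      exact (h3 l m hl hm x y z).trans (add_le_add hwl hwm)
    linarith
end

section
/- (Fundamental Modular Contraction Inequality) Let w be a convex metric modular on a set X, let x₀ ∈ X, and let T : X_w^*(x₀) → X_w^*(x₀) be a modular contractive mapping with constants k ∈ (0,1) and λ₀ > 0, i.e., w_{kλ}(Tx, Ty) ≤ w_λ(x, y) for all 0 < λ ≤ λ₀ and all x, y ∈ X_w^*(x₀). Let λ₁, λ₂ ≥ 0 with λ₁ + λ₂ = (1 − k)λ, where 0 < λ < λ₀ (and λ₁, λ₂ > 0). Then for every x, y ∈ X_w^*(x₀) with w_λ(x, y) < ∞, one has w_λ(x, y) ≤ (λ₁ w_{λ₁}(x, Tx) + λ₂ w_{λ₂}(y, Ty)) / (λ(1 − k)). -/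
open ENNReal

/-- The convexity inequality of a modular, cleared of denominators. -/
theorem ofReal_add_mul_modular_le {X : Type*} {w : ℝ → X → X → ℝ≥0∞}
    (hw : ∀ l m : ℝ, 0 < l → 0 < m → ∀ x y z : X,
      w (l + m) x y ≤ ENNReal.ofReal (l / (l + m)) * w l x z
        + ENNReal.ofReal (m / (l + m)) * w m z y)
    {l m : ℝ} (hl : 0 < l) (hm : 0 < m) (x y z : X) :
    ENNReal.ofReal (l + m) * w (l + m) x y
      ≤ ENNReal.ofReal l * w l x z + ENNReal.ofReal m * w m z y := by
  have hlm : 0 < l + m := add_pos hl hm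
  refine (mul_le_mul_right (hw l m hl hm x y z) _).trans_eq ?_
  rw [mul_add, ← mul_assoc, ← mul_assoc, ← ENNReal.ofReal_mul hlm.le,
    ← ENNReal.ofReal_mul hlm.le, mul_div_cancel₀ _ hlm.ne', mul_div_cancel₀ _ hlm.ne']

/-- Fundamental Modular Contraction Inequality: for a convex metric
modular `w` and a `w`-contraction `T` on the modular set `X_w^*(x₀)` (with constants
`k ∈ (0,1)`, `λ₀ > 0`), if `l₁, l₂ > 0`, `l₁ + l₂ = (1 - k) * l`, `0 < l < λ₀`, then
for all `x, y ∈ X_w^*(x₀)` with `w l x y < ∞`,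
`w l x y ≤ (l₁ * w l₁ x (T x) + l₂ * w l₂ y (T y)) / (l * (1 - k))`. -/
theorem fundamental_modular_contraction_inequality {X : Type*} (w : ℝ → X → X → ℝ≥0∞)
    (h1 : ∀ x y : X, (∀ l : ℝ, 0 < l → w l x y = 0) ↔ x = y)
    (h2 : ∀ l : ℝ, 0 < l → ∀ x y : X, w l x y = w l y x)
    (h3 : ∀ l m : ℝ, 0 < l → 0 < m → ∀ x y z : X,
      w (l + m) x y ≤ ENNReal.ofReal (l / (l + m)) * w l x z
        + ENNReal.ofReal (m / (l + m)) * w m z y)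
    (x₀ : X)
    (S : Set X) (hS : S = {x : X | ∃ l : ℝ, 0 < l ∧ w l x x₀ < ⊤})
    (T : X → X) (hTS : ∀ x ∈ S, T x ∈ S)
    (k lam0 : ℝ) (hk0 : 0 < k) (hk1 : k < 1) (hlam0 : 0 < lam0)
    (hT : ∀ l : ℝ, 0 < l → l ≤ lam0 → ∀ x ∈ S, ∀ y ∈ S,
      w (k * l) (T x) (T y) ≤ w l x y)
    (l l₁ l₂ : ℝ) (hl : 0 < l) (hllam0 : l < lam0)
    (hl₁ : 0 < l₁) (hl₂ : 0 < l₂) (hsum : l₁ + l₂ = (1 - k) * l)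
    (x : X) (hx : x ∈ S) (y : X) (hy : y ∈ S) (hfin : w l x y < ⊤) :
    w l x y ≤ (ENNReal.ofReal l₁ * w l₁ x (T x) + ENNReal.ofReal l₂ * w l₂ y (T y))
      / ENNReal.ofReal (l * (1 - k)) := by
  have hkl : 0 < k * l := mul_pos hk0 hl
  have hpos : 0 < l * (1 - k) := mul_pos hl (sub_pos.2 hk1)
  have hdecomp : l = l₁ + (k * l + l₂) := by linarith
  have hxy : ENNReal.ofReal l * w l x y ≤ ENNReal.ofReal l₁ * w l₁ x (T x)
      + ENNReal.ofReal (k * l + l₂) * w (k * l + l₂) (T x) y := by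
    have h := ofReal_add_mul_modular_le h3 hl₁ (add_pos hkl hl₂) x y (T x)
    rwa [← hdecomp] at h
  have hTxy : ENNReal.ofReal (k * l + l₂) * w (k * l + l₂) (T x) y
      ≤ ENNReal.ofReal (k * l) * w l x y + ENNReal.ofReal l₂ * w l₂ y (T y) := by
    refine (ofReal_add_mul_modular_le h3 hkl hl₂ (T x) y (T y)).trans ?_
    rw [h2 l₂ hl₂ (T y) y]
    gcongr
    exact hT l hl hllam0.le x hx y hy
  rw [ENNReal.le_div_iff_mul_le (Or.inl (ENNReal.ofReal_pos.2 hpos).ne')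
    (Or.inl ENNReal.ofReal_ne_top), mul_comm]
  have hkw : ENNReal.ofReal (k * l) * w l x y ≠ ⊤ :=
    ENNReal.mul_ne_top ENNReal.ofReal_ne_top hfin.ne
  refine (ENNReal.add_le_add_iff_right hkw).1 ?_
  calc
    ENNReal.ofReal (l * (1 - k)) * w l x y + ENNReal.ofReal (k * l) * w l x y
        = ENNReal.ofReal l * w l x y := by
      rw [← add_mul, ← ENNReal.ofReal_add hpos.le hkl.le]
      ring_nf
    _ ≤ ENNReal.ofReal l₁ * w l₁ x (T x)
        + (ENNReal.ofReal (k * l) * w l x y + ENNReal.ofReal l₂ * w l₂ y (T y)) :=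
      hxy.trans (by gcongr)
    _ = ENNReal.ofReal l₁ * w l₁ x (T x) + ENNReal.ofReal l₂ * w l₂ y (T y)
        + ENNReal.ofReal (k * l) * w l x y := by ring
end

section
/- (Fundamental Strong Modular Contraction Inequality) Let w be a metric modular on a set X, let x₀ ∈ X, and let T : X_w^*(x₀) → X_w^*(x₀) be a strongly modular contractive mapping with constants k ∈ (0,1) and λ₀ > 0, i.e., w_{kλ}(Tx, Ty) ≤ k·w_λ(x, y) for all 0 < λ ≤ λ₀ and all x, y ∈ X_w^*(x₀). Let λ₁, λ₂ ≥ 0 with λ₁ + λ₂ = (1 − k)λ, where 0 < λ < λ₀ (and λ₁, λ₂ > 0). Then for every x, y ∈ X_w^*(x₀) with w_λ(x, y) < ∞, one has w_λ(x, y) ≤ (w_{λ₁}(x, Tx) + w_{λ₂}(y, Ty)) / (1 − k). -/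
open ENNReal

/-- Fundamental Strong Modular Contraction Inequality: for a metric
modular `w` and a strong `w`-contraction `T` on the modular set `X_w^*(x₀)` (with
constants `k ∈ (0,1)`, `λ₀ > 0`), if `l₁, l₂ > 0`, `l₁ + l₂ = (1 - k) * l`,
`0 < l < λ₀`, then for all `x, y ∈ X_w^*(x₀)` with `w l x y < ∞`,
`w l x y ≤ (w l₁ x (T x) + w l₂ y (T y)) / (1 - k)`. -/
theorem fundamental_strong_modular_contraction_inequality {X : Type*}
    (w : ℝ → X → X → ℝ≥0∞)
    (h1 : ∀ x y : X, (∀ l : ℝ, 0 < l → w l x y = 0) ↔ x = y)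
    (h2 : ∀ l : ℝ, 0 < l → ∀ x y : X, w l x y = w l y x)
    (h3 : ∀ l m : ℝ, 0 < l → 0 < m → ∀ x y z : X, w (l + m) x y ≤ w l x z + w m z y)
    (x₀ : X)
    (S : Set X) (hS : S = {x : X | ∃ l : ℝ, 0 < l ∧ w l x x₀ < ⊤})
    (T : X → X) (hTS : ∀ x ∈ S, T x ∈ S)
    (k lam0 : ℝ) (hk0 : 0 < k) (hk1 : k < 1) (hlam0 : 0 < lam0)
    (hT : ∀ l : ℝ, 0 < l → l ≤ lam0 → ∀ x ∈ S, ∀ y ∈ S,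
      w (k * l) (T x) (T y) ≤ ENNReal.ofReal k * w l x y)
    (l l₁ l₂ : ℝ) (hl : 0 < l) (hllam0 : l < lam0)
    (hl₁ : 0 < l₁) (hl₂ : 0 < l₂) (hsum : l₁ + l₂ = (1 - k) * l)
    (x : X) (hx : x ∈ S) (y : X) (hy : y ∈ S) (hfin : w l x y < ⊤) :
    w l x y ≤ (w l₁ x (T x) + w l₂ y (T y)) / ENNReal.ofReal (1 - k) := by
  have h_split : w l x y ≤ w l₁ x (T x) + (w (k * l) (T x) (T y) + w l₂ (T y) y) := by
    have hkl : 0 < k * l := mul_pos hk0 hl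
    have hl_eq : l = l₁ + (k * l + l₂) := by linarith
    calc w l x y = w (l₁ + (k * l + l₂)) x y := by rw [← hl_eq]
      _ ≤ w l₁ x (T x) + w (k * l + l₂) (T x) y := h3 _ _ hl₁ (by positivity) _ _ _
      _ ≤ _ := by
        gcongr
        exact h3 _ _ hkl hl₂ _ _ _
  have h_sum : ENNReal.ofReal (1 - k) + ENNReal.ofReal k = 1 := by
    rw [← ENNReal.ofReal_add (by linarith) hk0.le]
    simp
  have h_ne_top : ENNReal.ofReal k * w l x y ≠ ⊤ :=
    ENNReal.mul_ne_top ENNReal.ofReal_ne_top hfin.ne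
  have h_ne_zero : ENNReal.ofReal (1 - k) ≠ 0 := (ENNReal.ofReal_pos.2 (by linarith)).ne'
  rw [ENNReal.le_div_iff_mul_le (.inl h_ne_zero) (.inl ENNReal.ofReal_ne_top)]
  refine (ENNReal.add_le_add_iff_right h_ne_top).1 ?_
  calc w l x y * ENNReal.ofReal (1 - k) + ENNReal.ofReal k * w l x y
      = (ENNReal.ofReal (1 - k) + ENNReal.ofReal k) * w l x y := by ring
    _ = w l x y := by rw [h_sum, one_mul]
    _ ≤ w l₁ x (T x) + (w (k * l) (T x) (T y) + w l₂ (T y) y) := h_split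
    _ ≤ w l₁ x (T x) + (ENNReal.ofReal k * w l x y + w l₂ y (T y)) := by
      rw [h2 l₂ hl₂ (T y) y]
      gcongr
      exact hT l hl hllam0.le x hx y hy
    _ = w l₁ x (T x) + w l₂ y (T y) + ENNReal.ofReal k * w l x y := by ring
end

section
/- (Chistyakov's second fixed point theorem) Let w be a strict metric modular on a set X, let x₀ ∈ X, and suppose the modular set X_w^*(x₀) is w-complete. Let T : X_w^*(x₀) → X_w^*(x₀) be a strongly modular contractive mapping (with constants k ∈ (0,1) and λ₀ > 0) such that for each λ > 0 there exists x = x(λ) ∈ X_w^*(x₀) with w_λ(x, Tx) < ∞. Then T has a fixed point x* in X_w^*(x₀). If moreover w takes only finite values on X_w^*(x₀) × X_w^*(x₀), then the fixed point x* is unique and for each initial point y₀ ∈ X_w^*(x₀) the sequence of iterates (Tⁿ y₀) is modular convergent to x*. -/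
open ENNReal Filter Topology

theorem modular_antitone_s17 {X : Type*} {w : ℝ → X → X → ℝ≥0∞}
    (hself : ∀ l : ℝ, 0 < l → ∀ x : X, w l x x = 0)
    (htri : ∀ l m : ℝ, 0 < l → 0 < m → ∀ x y z : X, w (l + m) x y ≤ w l x z + w m z y)
    {a b : ℝ} (ha : 0 < a) (hab : a ≤ b) (x y : X) : w b x y ≤ w a x y := by
  rcases hab.eq_or_lt with rfl | hlt
  · exact le_rfl
  · have h := htri a (b - a) ha (sub_pos.2 hlt) x y y
    rwa [hself _ (sub_pos.2 hlt), add_zero, add_sub_cancel] at h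

theorem modular_iterate_le {X : Type*} {w : ℝ → X → X → ℝ≥0∞} {S : Set X} {T : X → X}
    (hTS : Set.MapsTo T S S) {k lam : ℝ} (hk0 : 0 < k) (hk1 : k < 1)
    (hT : ∀ l : ℝ, 0 < l → l ≤ lam → ∀ x ∈ S, ∀ y ∈ S,
      w (k * l) (T x) (T y) ≤ ENNReal.ofReal k * w l x y)
    (hlam : 0 < lam) {x y : X} (hx : x ∈ S) (hy : y ∈ S) (n : ℕ) :
    w (k ^ n * lam) (T^[n] x) (T^[n] y) ≤ ENNReal.ofReal k ^ n * w lam x y := by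
  induction n with
  | zero => simp
  | succ n ih =>
    have h := hT (k ^ n * lam) (by positivity)
      (mul_le_of_le_one_left hlam.le (pow_le_one₀ hk0.le hk1.le))
      _ (hTS.iterate n hx) _ (hTS.iterate n hy)
    rw [Function.iterate_succ_apply', Function.iterate_succ_apply', pow_succ', pow_succ',
      mul_assoc, mul_assoc]
    exact h.trans (by gcongr)

theorem tendsto_ofReal_pow_mul_zero {k : ℝ} (hk1 : k < 1) {D : ℝ≥0∞} (hD : D ≠ ⊤) :
    Tendsto (fun n : ℕ => ENNReal.ofReal k ^ n * D) atTop (𝓝 0) := by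
  have h := ENNReal.Tendsto.mul_const (b := D)
    (ENNReal.tendsto_pow_atTop_nhds_zero_of_lt_one (ENNReal.ofReal_lt_one.2 hk1)) (Or.inr hD)
  rwa [zero_mul] at h

/-- Chistyakov's second fixed point theorem: let `w` be a strict
metric modular on `X`, with `X_w^*(x₀)` `w`-complete, and let `T` be a strong
`w`-contraction on `X_w^*(x₀)` such that for each `l > 0` some `x ∈ X_w^*(x₀)`
has `w l x (T x) < ∞`.  Then `T` has a fixed point in `X_w^*(x₀)`; if moreover
`w` is finite-valued on `X_w^*(x₀)`, the fixed point is unique and every orbit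
is modular convergent to it. -/
theorem chistyakov_second_fixed_point {X : Type*} (w : ℝ → X → X → ℝ≥0∞)
    (h1 : ∀ x y : X, (∀ l : ℝ, 0 < l → w l x y = 0) ↔ x = y)
    (h2 : ∀ l : ℝ, 0 < l → ∀ x y : X, w l x y = w l y x)
    (h3 : ∀ l m : ℝ, 0 < l → 0 < m → ∀ x y z : X,
      w (l + m) x y ≤ w l x z + w m z y)
    (hstrict : ∀ x y : X, x ≠ y → ∀ l : ℝ, 0 < l → 0 < w l x y)
    (x₀ : X)
    (S : Set X) (hS : S = {x : X | ∃ l : ℝ, 0 < l ∧ w l x x₀ < ⊤})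
    (hcomplete : ∀ u : ℕ → X, (∀ n, u n ∈ S) → ∀ l : ℝ, 0 < l →
      Tendsto (fun p : ℕ × ℕ => w l (u p.1) (u p.2)) atTop (𝓝 0) →
      ∃ x ∈ S, Tendsto (fun n => w l (u n) x) atTop (𝓝 0))
    (T : X → X) (hTS : ∀ x ∈ S, T x ∈ S)
    (k lam0 : ℝ) (hk0 : 0 < k) (hk1 : k < 1) (hlam0 : 0 < lam0)
    (hT : ∀ l : ℝ, 0 < l → l ≤ lam0 → ∀ x ∈ S, ∀ y ∈ S,
      w (k * l) (T x) (T y) ≤ ENNReal.ofReal k * w l x y)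
    (hfin : ∀ l : ℝ, 0 < l → ∃ x ∈ S, w l x (T x) < ⊤) :
    (∃ xs ∈ S, T xs = xs) ∧
    ((∀ l : ℝ, 0 < l → ∀ x ∈ S, ∀ y ∈ S, w l x y < ⊤) →
      ∃ xs, xs ∈ S ∧ T xs = xs ∧
        (∀ y ∈ S, T y = y → y = xs) ∧
        (∀ y₀ ∈ S, ∃ l : ℝ, 0 < l ∧
          Tendsto (fun n => w l (T^[n] y₀) xs) atTop (𝓝 0))) := by
  have hself : ∀ l : ℝ, 0 < l → ∀ x : X, w l x x = 0 := fun l hl x => (h1 x x).2 rfl l hl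
  have hmono : ∀ {a b : ℝ}, 0 < a → a ≤ b → ∀ x y : X, w b x y ≤ w a x y :=
    fun ha hab x y => modular_antitone_s17 hself h3 ha hab x y
  have hzero : ∀ {l : ℝ}, 0 < l → ∀ {x y : X}, w l x y = 0 → x = y := fun hl x y h => by
    by_contra hne
    exact (hstrict x y hne _ hl).ne' h
  have hiter : ∀ {x y : X}, x ∈ S → y ∈ S → ∀ n : ℕ,
      w lam0 (T^[n] x) (T^[n] y) ≤ ENNReal.ofReal k ^ n * w lam0 x y := fun hx hy n =>
    (hmono (by positivity) (mul_le_of_le_one_left hlam0.le (pow_le_one₀ hk0.le hk1.le)) _ _).trans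
      (modular_iterate_le hTS hk0 hk1 hT hlam0 hx hy n)
  have hmem : ∀ {x : X}, x ∈ S → ∀ n : ℕ, T^[n] x ∈ S := fun hx n =>
    Set.MapsTo.iterate hTS n hx
  have hk1' : 0 < 1 - k := sub_pos.2 hk1
  have hexists : ∃ xs ∈ S, T xs = xs := by
    obtain ⟨x, hx, hxfin⟩ := hfin ((1 - k) * lam0) (by positivity)
    obtain ⟨D, hDtop, hD⟩ : ∃ D : ℝ≥0∞, D ≠ ⊤ ∧
        w ((1 - k) * lam0) x (T x) + ENNReal.ofReal k * D = D := by
      refine ⟨ENNReal.ofReal ((w ((1 - k) * lam0) x (T x)).toReal / (1 - k)),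
        ENNReal.ofReal_ne_top, ?_⟩
      nth_rewrite 1 [← ENNReal.ofReal_toReal hxfin.ne]
      rw [← ENNReal.ofReal_mul hk0.le, ← ENNReal.ofReal_add ENNReal.toReal_nonneg (by positivity)]
      congr 1
      field_simp
      ring
    have hbound : ∀ m : ℕ, w lam0 x (T^[m] x) ≤ D := by
      intro m
      induction m with
      | zero => simp [hself _ hlam0]
      | succ m ih =>
        have h := h3 ((1 - k) * lam0) (k * lam0) (by positivity) (by positivity)
          x (T^[m + 1] x) (T x)
        rw [← add_mul, sub_add_cancel, one_mul] at h
        refine h.trans (le_of_le_of_eq ?_ hD)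
        gcongr
        rw [Function.iterate_succ_apply']
        exact (hT lam0 hlam0 le_rfl _ hx _ (hmem hx m)).trans (by gcongr)
    have hgap : ∀ {n m : ℕ}, n ≤ m →
        w lam0 (T^[n] x) (T^[m] x) ≤ ENNReal.ofReal k ^ n * D := by
      intro n m hnm
      obtain ⟨j, rfl⟩ := Nat.exists_eq_add_of_le hnm
      rw [Function.iterate_add_apply]
      refine (hiter hx (hmem hx j) n).trans ?_
      gcongr
      exact hbound j
    have hpow := tendsto_ofReal_pow_mul_zero hk1 hDtop
    obtain ⟨xs, hxs, hlim⟩ := hcomplete (fun n => T^[n] x) (hmem hx) lam0 hlam0 (by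
      have hsum : Tendsto (fun p : ℕ × ℕ =>
          ENNReal.ofReal k ^ p.1 * D + ENNReal.ofReal k ^ p.2 * D) atTop (𝓝 0) := by
        rw [← prod_atTop_atTop_eq, ← add_zero (0 : ℝ≥0∞)]
        exact (hpow.comp tendsto_fst).add (hpow.comp tendsto_snd)
      refine tendsto_of_tendsto_of_tendsto_of_le_of_le tendsto_const_nhds hsum
        (fun _ => zero_le) fun p => ?_
      rcases le_total p.1 p.2 with h | h
      · exact (hgap h).trans le_self_add
      · exact (h2 _ hlam0 _ _).trans_le ((hgap h).trans le_add_self))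
    refine ⟨xs, hxs, (hzero (l := lam0 + k * lam0) (by positivity) ?_).symm⟩
    have hlim' : Tendsto (fun n => w lam0 (T^[n + 1] x) xs +
        ENNReal.ofReal k * w lam0 (T^[n] x) xs) atTop (𝓝 0) := by
      have h := (hlim.comp (tendsto_add_atTop_nat 1)).add
        (ENNReal.Tendsto.const_mul hlim (Or.inr (ENNReal.ofReal_ne_top (r := k))))
      rwa [mul_zero, add_zero] at h
    refine le_antisymm (ge_of_tendsto' hlim' fun n => ?_) zero_le
    refine (h3 lam0 (k * lam0) hlam0 (by positivity) xs (T xs) (T^[n + 1] x)).trans ?_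
    rw [h2 lam0 hlam0 xs]
    gcongr
    rw [Function.iterate_succ_apply']
    exact hT lam0 hlam0 le_rfl _ (hmem hx n) _ hxs
  refine ⟨hexists, fun hfinite => ?_⟩
  obtain ⟨xs, hxs, hfix⟩ := hexists
  have hconv : ∀ y ∈ S, Tendsto (fun n => w lam0 (T^[n] y) xs) atTop (𝓝 0) := fun y hy => by
    refine tendsto_of_tendsto_of_tendsto_of_le_of_le tendsto_const_nhds
      (tendsto_ofReal_pow_mul_zero hk1 (hfinite lam0 hlam0 y hy xs hxs).ne)
      (fun _ => zero_le) fun n => ?_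
    have h := hiter hy hxs n
    rwa [Function.iterate_fixed hfix] at h
  refine ⟨xs, hxs, hfix, fun y hy hyfix => hzero hlam0 ?_, fun y hy => ⟨lam0, hlam0, hconv y hy⟩⟩
  have h := hconv y hy
  simp only [Function.iterate_fixed hyfix] at h
  exact tendsto_nhds_unique tendsto_const_nhds h
end
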